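/- There exists a constant β > 0 such that the following holds. For every finite simple connected undirected graph G with m edges in which every vertex has degree at least 1, for every pair of vertices x, y and every natural number t with t ≤ β·m², the second moment of the number of visits to y by the lazy simple random walk of length t started at x satisfies E[(N_t^x(y))²] ≤ E[N_t^x(y)] + 128·d(y)²·(t+1). -/

import Mathlib

open Finset

section Defs

variable {V : Type} [Fintype V] [DecidableEq V]

/-- Transition kernel of the lazy simple random walk on `G`. -/
noncomputable def lazyStep (G : SimpleGraph V) [DecidableRel G.Adj] (u v : V) : ℝ :=
  if u = v then 1 / 2 else if G.Adj u v then 1 / (2 * (G.degree u : ℝ)) else 0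

/-- Law (probability mass function) of the lazy random walk of length `t` started at `x`,
as a function on trajectories `Fin (t+1) → V`. -/
noncomputable def lazyWalkLaw (G : SimpleGraph V) [DecidableRel G.Adj] (x : V) (t : ℕ)
    (f : Fin (t + 1) → V) : ℝ :=
  (if f 0 = x then 1 else 0) * ∏ i : Fin t, lazyStep G (f i.castSucc) (f i.succ)

/-- Probability of an event `E` of trajectories, under the lazy walk law. -/
noncomputable def lazyWalkPr (G : SimpleGraph V) [DecidableRel G.Adj] (x : V) (t : ℕ)
    (E : Set (Fin (t + 1) → V)) : ℝ :=
  ∑ f : Fin (t + 1) → V, E.indicator (lazyWalkLaw G x t) f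

/-- Expectation of a random variable `N` of the trajectory, under the lazy walk law. -/
noncomputable def lazyWalkExp (G : SimpleGraph V) [DecidableRel G.Adj] (x : V) (t : ℕ)
    (N : (Fin (t + 1) → V) → ℝ) : ℝ :=
  ∑ f : Fin (t + 1) → V, lazyWalkLaw G x t f * N f

/-- Number of indices `0 ≤ i ≤ t` at which the trajectory `f` visits `y`. -/
def visits (y : V) {t : ℕ} (f : Fin (t + 1) → V) : ℕ :=
  (Finset.univ.filter fun i => f i = y).card

end Defs

section Aux

variable {V : Type} [Fintype V] [DecidableEq V]

/-- Expected number of visits to `y` up to time `t`, by first-step recursion. -/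
noncomputable def visA (G : SimpleGraph V) [DecidableRel G.Adj] (y : V) : ℕ → V → ℝ
  | 0, v => if v = y then 1 else 0
  | t + 1, v => (if v = y then 1 else 0) + ∑ w, lazyStep G v w * visA G y t w

variable (G : SimpleGraph V) [DecidableRel G.Adj]

lemma lazyStep_nonneg (u v : V) : 0 ≤ lazyStep G u v := by
  unfold lazyStep
  split_ifs <;> positivity

/-- Weighted step: `d(v) Q(v,w)`, for `d(v) ≥ 1`. -/
lemma deg_mul_lazyStep (hd : ∀ v : V, 1 ≤ G.degree v) (v w : V) :
    (G.degree v : ℝ) * lazyStep G v w =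
      (if v = w then (G.degree v : ℝ) / 2 else 0) + (if G.Adj v w then 1 / 2 else 0) := by
  have h : (G.degree v : ℝ) ≠ 0 := by have := hd v; positivity
  unfold lazyStep
  by_cases h1 : v = w
  · subst h1; simp; ring
  · by_cases h2 : G.Adj v w
    · simp [h1, h2]; field_simp
    · simp [h1, h2]

lemma sum_adj (v : V) : (∑ w, if G.Adj v w then (1 : ℝ) / 2 else 0) = (G.degree v : ℝ) / 2 := by
  rw [← Finset.sum_filter, Finset.sum_const, ← SimpleGraph.neighborFinset_eq_filter,
    SimpleGraph.card_neighborFinset_eq_degree, nsmul_eq_mul]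
  ring

lemma lazyStep_sum (hd : ∀ v : V, 1 ≤ G.degree v) (v : V) : ∑ w, lazyStep G v w = 1 := by
  have h : (G.degree v : ℝ) ≠ 0 := by have := hd v; positivity
  apply mul_left_cancel₀ h
  rw [Finset.mul_sum]
  simp_rw [deg_mul_lazyStep G hd]
  rw [Finset.sum_add_distrib, sum_adj]
  simp

lemma lazyStep_stat (hd : ∀ v : V, 1 ≤ G.degree v) (w : V) :
    ∑ v, (G.degree v : ℝ) * lazyStep G v w = G.degree w := by
  simp_rw [deg_mul_lazyStep G hd]
  rw [Finset.sum_add_distrib]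
  simp_rw [SimpleGraph.adj_comm G _ w]
  rw [sum_adj]
  simp

lemma visA_nonneg (y : V) (t : ℕ) (v : V) : 0 ≤ visA G y t v := by
  induction t generalizing v with
  | zero => simp only [visA]; split_ifs <;> norm_num
  | succ t ih =>
    simp only [visA]
    have : 0 ≤ ∑ w, lazyStep G v w * visA G y t w :=
      Finset.sum_nonneg fun w _ => mul_nonneg (lazyStep_nonneg G v w) (ih w)
    split_ifs <;> linarith

lemma visA_mono (y : V) (t : ℕ) (v : V) : visA G y t v ≤ visA G y (t + 1) v := by
  induction t generalizing v with
  | zero =>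
    rw [visA, visA]
    have : 0 ≤ ∑ w, lazyStep G v w * visA G y 0 w :=
      Finset.sum_nonneg fun w _ => mul_nonneg (lazyStep_nonneg G v w) (visA_nonneg G y 0 w)
    linarith
  | succ t ih =>
    rw [visA, visA]
    gcongr with w
    · exact lazyStep_nonneg G v w
    · exact ih w

lemma step_le (hd : ∀ v : V, 1 ≤ G.degree v) (g : V → ℝ) (c : ℝ) (h : ∀ w, g w ≤ c) (v : V) :
    ∑ w, lazyStep G v w * g w ≤ c := by
  calc ∑ w, lazyStep G v w * g w ≤ ∑ w, lazyStep G v w * c := by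
        gcongr with w
        · exact lazyStep_nonneg G v w
        · exact h w
    _ = c := by rw [← Finset.sum_mul, lazyStep_sum G hd, one_mul]

lemma visA_le (hd : ∀ v : V, 1 ≤ G.degree v) (y : V) (t : ℕ) (v : V) :
    visA G y t v ≤ visA G y t y := by
  induction t generalizing v with
  | zero => simp only [visA]; split_ifs <;> simp_all
  | succ t ih =>
    by_cases h : v = y
    · rw [h]
    · refine le_trans ?_ (visA_mono G y t y)
      rw [visA, if_neg h, zero_add]
      exact step_le G hd _ _ ih v

lemma visA_mass (hd : ∀ v : V, 1 ≤ G.degree v) (y : V) (t : ℕ) :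
    ∑ v, (G.degree v : ℝ) * visA G y t v = (t + 1) * G.degree y := by
  induction t with
  | zero => simp [visA]
  | succ t ih =>
    simp_rw [visA, mul_add, Finset.sum_add_distrib, Finset.mul_sum]
    rw [Finset.sum_comm]
    simp_rw [← mul_assoc, ← Finset.sum_mul, lazyStep_stat G hd]
    rw [ih]
    simp
    ring

lemma energy_eq (hd : ∀ v : V, 1 ≤ G.degree v) (u : V → ℝ) :
    ∑ v, ∑ w, (if G.Adj v w then (u v - u w) ^ 2 else 0) =
      4 * ∑ v, (G.degree v : ℝ) * u v * (u v - ∑ w, lazyStep G v w * u w) := by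
  have h1 : ∀ v, (G.degree v : ℝ) * u v * (u v - ∑ w, lazyStep G v w * u w) =
      ∑ w, (if G.Adj v w then (1 / 2 : ℝ) * (u v * (u v - u w)) else 0) := by
    intro v
    have e : (G.degree v : ℝ) * ∑ w, lazyStep G v w * u w =
        (G.degree v : ℝ) / 2 * u v + ∑ w, (if G.Adj v w then (1 / 2 : ℝ) else 0) * u w := by
      rw [Finset.mul_sum]
      simp_rw [← mul_assoc, deg_mul_lazyStep G hd, add_mul]
      rw [Finset.sum_add_distrib]
      simp
    have e2 : ∑ w, (if G.Adj v w then (1 / 2 : ℝ) * (u v * (u v - u w)) else 0) =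
        u v ^ 2 * (∑ w, if G.Adj v w then (1 : ℝ) / 2 else 0) -
          u v * ∑ w, (if G.Adj v w then (1 / 2 : ℝ) else 0) * u w := by
      rw [Finset.mul_sum, Finset.mul_sum, ← Finset.sum_sub_distrib]
      refine Finset.sum_congr rfl fun w _ => ?_
      split_ifs <;> ring
    rw [e2, sum_adj]
    linear_combination (-u v) * e
  simp_rw [h1]
  have h2 : ∑ v, ∑ w, (if G.Adj v w then (1 / 2 : ℝ) * (u v * (u v - u w)) else 0) =
      ∑ v, ∑ w, (if G.Adj v w then (1 / 2 : ℝ) * (u w * (u w - u v)) else 0) := by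
    rw [Finset.sum_comm]
    simp_rw [SimpleGraph.adj_comm]
  have h3 : ∑ v, ∑ w, (if G.Adj v w then (u v - u w) ^ 2 else 0) =
      2 * ∑ v, ∑ w, (if G.Adj v w then (1 / 2 : ℝ) * (u v * (u v - u w)) else 0) +
      2 * ∑ v, ∑ w, (if G.Adj v w then (1 / 2 : ℝ) * (u w * (u w - u v)) else 0) := by
    simp_rw [Finset.mul_sum, ← Finset.sum_add_distrib]
    refine Finset.sum_congr rfl fun v _ => Finset.sum_congr rfl fun w _ => ?_
    split_ifs <;> ring
  rw [h3, ← h2]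
  ring

lemma energy_le (hd : ∀ v : V, 1 ≤ G.degree v) (y : V) (t : ℕ) :
    ∑ v, ∑ w, (if G.Adj v w then (visA G y t v - visA G y t w) ^ 2 else 0) ≤
      4 * (G.degree y * visA G y t y) := by
  rw [energy_eq G hd]
  gcongr
  calc _ ≤ ∑ v, (G.degree v : ℝ) * visA G y t v * (if v = y then 1 else 0) := by
        gcongr with v
        · exact mul_nonneg (by positivity) (visA_nonneg G y t v)
        · have := visA_mono G y t v
          rw [visA] at this
          linarith
    _ = _ := by simp

/-- Key bound. -/
lemma visA_sq_le (hc : G.Connected) (hd : ∀ v : V, 1 ≤ G.degree v) (y : V) (t : ℕ)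
    (ht : (t : ℝ) ≤ 1 * (G.edgeFinset.card : ℝ) ^ 2) :
    visA G y t y ^ 2 ≤ 32 * (G.degree y : ℝ) ^ 2 * (t + 1) := by
  set M := visA G y t y with hM
  have hM0 : 0 ≤ M := visA_nonneg G y t y
  have hmass := visA_mass G hd y t
  have hE := energy_le G hd y t
  set u := visA G y t with hu
  have hu0 : ∀ v, 0 ≤ u v := visA_nonneg G y t
  have hdy : (1 : ℝ) ≤ G.degree y := by exact_mod_cast hd y
  rcases hM0.eq_or_lt with h0 | hMpos
  · rw [← h0, zero_pow two_ne_zero]; positivity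
  by_cases hall : ∀ v, M / 2 ≤ u v
  · have hsum : ∑ v, (G.degree v : ℝ) = 2 * (G.edgeFinset.card : ℝ) := by
      exact_mod_cast G.sum_degrees_eq_twice_card_edges
    have h1 : (G.edgeFinset.card : ℝ) * M ≤ (t + 1) * G.degree y := by
      rw [← hmass]
      calc (G.edgeFinset.card : ℝ) * M = ∑ v, (G.degree v : ℝ) * (M / 2) := by
            rw [← Finset.sum_mul, hsum]; ring
        _ ≤ _ := by gcongr with v; exact hall v
    have hm : (1 : ℝ) ≤ G.edgeFinset.card := by
      have : (G.degree y : ℝ) ≤ ∑ v, (G.degree v : ℝ) :=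
        Finset.single_le_sum (f := fun v => (G.degree v : ℝ)) (fun v _ => by positivity)
          (Finset.mem_univ y)
      rw [hsum] at this
      have h2 : 0 < G.edgeFinset.card := by
        rw [pos_iff_ne_zero]; intro h; rw [h] at this; push_cast at this; linarith
      exact_mod_cast h2
    set m : ℝ := (G.edgeFinset.card : ℝ) with hmdef
    have h2 : (m * M) ^ 2 ≤ ((t + 1) * G.degree y) ^ 2 := by gcongr
    have h3 : (t : ℝ) + 1 ≤ 2 * m ^ 2 := by nlinarith
    have h4 : ((t + 1) * (G.degree y : ℝ)) ^ 2 ≤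
        m ^ 2 * (2 * (G.degree y : ℝ) ^ 2 * (t + 1)) := by
      calc ((t + 1) * (G.degree y : ℝ)) ^ 2 = (t + 1) * ((G.degree y : ℝ) ^ 2 * (t + 1)) := by ring
        _ ≤ (2 * m ^ 2) * ((G.degree y : ℝ) ^ 2 * (t + 1)) := by gcongr
        _ = _ := by ring
    have h5 : m ^ 2 * M ^ 2 ≤ m ^ 2 * (2 * (G.degree y : ℝ) ^ 2 * (t + 1)) := by
      rw [← mul_pow]; exact h2.trans h4
    have h6 := le_of_mul_le_mul_left h5 (by positivity)
    refine h6.trans ?_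
    gcongr
    norm_num
  · push Not at hall
    obtain ⟨w, hw, hmin⟩ := Set.exists_min_image {v | u v < M / 2} (G.dist y)
      (Set.toFinite _) hall
    obtain ⟨p, hp, hlen⟩ := hc.exists_path_of_dist y w
    set r := G.dist y w with hr
    have hbig : ∀ i < r, M / 2 ≤ u (p.getVert i) := by
      intro i hi
      by_contra hcon
      push Not at hcon
      have h1 := hmin (p.getVert i) hcon
      have h2 : G.dist y (p.getVert i) ≤ i := by
        refine (SimpleGraph.dist_le (p.take i)).trans ?_
        simp
      omega
    have hinj : Set.InjOn p.getVert (Finset.range r : Set ℕ) := by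
      intro i hi j hj hij
      simp only [Finset.coe_range, Set.mem_Iio] at hi hj
      exact hp.getVert_injOn (by simp; omega) (by simp; omega) hij
    have hvol : (r : ℝ) * (M / 2) ≤ (t + 1) * G.degree y := by
      rw [← hmass]
      calc (r : ℝ) * (M / 2) = ∑ i ∈ Finset.range r, M / 2 := by simp
        _ ≤ ∑ i ∈ Finset.range r, (G.degree (p.getVert i) : ℝ) * u (p.getVert i) := by
            refine Finset.sum_le_sum fun i hi => ?_
            have h1 := hbig i (Finset.mem_range.1 hi)
            have h2 : (1 : ℝ) ≤ G.degree (p.getVert i) := by exact_mod_cast hd _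
            nlinarith [hu0 (p.getVert i)]
        _ = ∑ v ∈ (Finset.range r).image p.getVert, (G.degree v : ℝ) * u v := by
            rw [Finset.sum_image hinj]
        _ ≤ _ := Finset.sum_le_sum_of_subset_of_nonneg (Finset.subset_univ _)
            fun v _ _ => mul_nonneg (by positivity) (hu0 v)
    have hen : ∑ i ∈ Finset.range r, (u (p.getVert i) - u (p.getVert (i + 1))) ^ 2 ≤
        4 * (G.degree y * M) := by
      refine le_trans ?_ hE
      calc _ ≤ ∑ i ∈ Finset.range r, ∑ w,
              (if G.Adj (p.getVert i) w then (u (p.getVert i) - u w) ^ 2 else 0) := by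
            refine Finset.sum_le_sum fun i hi => ?_
            have hadj : G.Adj (p.getVert i) (p.getVert (i + 1)) :=
              p.adj_getVert_succ (by rw [hlen]; exact Finset.mem_range.1 hi)
            have := Finset.single_le_sum (f := fun w =>
              (if G.Adj (p.getVert i) w then (u (p.getVert i) - u w) ^ 2 else 0))
              (fun w _ => by split_ifs <;> positivity)
              (Finset.mem_univ (p.getVert (i + 1)))
            simpa [hadj] using this
        _ = ∑ v ∈ (Finset.range r).image p.getVert, ∑ w,
              (if G.Adj v w then (u v - u w) ^ 2 else 0) := by
            rw [Finset.sum_image hinj]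
        _ ≤ _ := Finset.sum_le_sum_of_subset_of_nonneg (Finset.subset_univ _)
            fun v _ _ => Finset.sum_nonneg fun w _ => by split_ifs <;> positivity
    have htel : ∑ i ∈ Finset.range r, (u (p.getVert i) - u (p.getVert (i + 1))) = M - u w := by
      rw [Finset.sum_range_sub' (fun i => u (p.getVert i))]
      have : p.getVert r = w := by rw [← hlen]; exact p.getVert_length
      rw [this]; simp [hM]
    have hcs := sq_sum_le_card_mul_sum_sq (s := Finset.range r)
      (f := fun i => u (p.getVert i) - u (p.getVert (i + 1)))
    rw [htel, Finset.card_range] at hcs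
    have hw' : u w < M / 2 := hw
    have h1 : (M / 2) ^ 2 ≤ r * (4 * (G.degree y * M)) :=
      calc (M / 2) ^ 2 ≤ (M - u w) ^ 2 := by
            apply pow_le_pow_left₀ <;> linarith
        _ ≤ _ := hcs
        _ ≤ _ := by gcongr
    have h2 : (r : ℝ) * (M / 2) * G.degree y ≤ (t + 1) * G.degree y * G.degree y := by gcongr
    nlinarith

lemma exp_succ (x : V) (t : ℕ) (F : (Fin (t + 2) → V) → ℝ) :
    lazyWalkExp G x (t + 1) F =
      ∑ w, lazyStep G x w * lazyWalkExp G w t (fun f => F (Fin.cons x f)) := by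
  unfold lazyWalkExp
  rw [← (Fin.consEquiv (fun _ : Fin (t + 2) => V)).sum_comp, Fintype.sum_prod_type]
  simp_rw [Finset.mul_sum]
  rw [Finset.sum_eq_single x]
  · rw [Finset.sum_comm]
    refine Finset.sum_congr rfl fun f _ => ?_
    rw [Finset.sum_eq_single (f 0)]
    · simp [lazyWalkLaw, Fin.prod_univ_succ, Fin.consEquiv, mul_assoc]
    · intro b _ hb
      simp [lazyWalkLaw, hb.symm]
    · simp
  · intro b _ hb
    simp [lazyWalkLaw, hb, Fin.consEquiv]
  · simp

lemma exp_zero (x : V) (F : (Fin 1 → V) → ℝ) :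
    lazyWalkExp G x 0 F = F (fun _ => x) := by
  unfold lazyWalkExp
  rw [Finset.sum_eq_single (fun _ => x)]
  · simp [lazyWalkLaw]
  · intro b _ hb
    have : b 0 ≠ x := fun h => hb (by
      funext i
      have hi : i = 0 := by ext; simp
      rw [hi, h])
    simp [lazyWalkLaw, this]
  · simp

lemma exp_add (x : V) (t : ℕ) (F H : (Fin (t + 1) → V) → ℝ) :
    lazyWalkExp G x t (fun f => F f + H f) = lazyWalkExp G x t F + lazyWalkExp G x t H := by
  simp [lazyWalkExp, mul_add, Finset.sum_add_distrib]

lemma exp_mul (x : V) (t : ℕ) (c : ℝ) (F : (Fin (t + 1) → V) → ℝ) :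
    lazyWalkExp G x t (fun f => c * F f) = c * lazyWalkExp G x t F := by
  simp only [lazyWalkExp, Finset.mul_sum]
  exact Finset.sum_congr rfl fun f _ => by ring

lemma exp_one (hd : ∀ v : V, 1 ≤ G.degree v) (x : V) (t : ℕ) :
    lazyWalkExp G x t (fun _ => 1) = 1 := by
  induction t generalizing x with
  | zero => rw [exp_zero]
  | succ t ih => rw [exp_succ]; simp_rw [ih]; simpa using lazyStep_sum G hd x

lemma visits_cons (x y : V) (t : ℕ) (f : Fin (t + 1) → V) :
    (visits y (t := t + 1) (Fin.cons x f : Fin (t + 2) → V) : ℝ) =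
      (if x = y then 1 else 0) + (visits y f : ℝ) := by
  simp only [visits, Finset.card_filter]
  rw [Fin.sum_univ_succ]
  simp

lemma exp_visits (hd : ∀ v : V, 1 ≤ G.degree v) (x y : V) (t : ℕ) :
    lazyWalkExp G x t (fun f => (visits y f : ℝ)) = visA G y t x := by
  induction t generalizing x with
  | zero => rw [exp_zero]; by_cases h : x = y <;> simp [visits, visA, h]
  | succ t ih =>
    rw [exp_succ, visA]
    simp_rw [visits_cons, exp_add, ih, mul_add, Finset.sum_add_distrib]
    congr 1
    have : ∀ w, lazyWalkExp G w t (fun _ => if x = y then (1 : ℝ) else 0) =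
        if x = y then 1 else 0 := by
      intro w
      have := exp_mul G w t (if x = y then (1 : ℝ) else 0) (fun _ => 1)
      rw [exp_one G hd] at this
      simpa using this
    simp_rw [this, ← Finset.sum_mul, lazyStep_sum G hd, one_mul]

lemma exp_fact (hd : ∀ v : V, 1 ≤ G.degree v) (x y : V) (t : ℕ) :
    lazyWalkExp G x t (fun f => (visits y f : ℝ) * ((visits y f : ℝ) - 1)) ≤
      2 * visA G y t y * visA G y t x := by
  induction t generalizing x with
  | zero =>
    rw [exp_zero]
    simp only [visits, visA, Finset.card_filter]
    by_cases h : x = y <;> simp [h]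
  | succ t ih =>
    rw [exp_succ]
    have key : ∀ w, lazyWalkExp G w t (fun f =>
        (visits y (t := t + 1) (Fin.cons x f : Fin (t + 2) → V) : ℝ) *
          ((visits y (t := t + 1) (Fin.cons x f : Fin (t + 2) → V) : ℝ) - 1)) =
        lazyWalkExp G w t (fun f => (visits y f : ℝ) * ((visits y f : ℝ) - 1)) +
          (if x = y then 2 else 0) * visA G y t w := by
      intro w
      rw [← exp_visits G hd, ← exp_mul, ← exp_add]
      congr 1
      funext f
      rw [visits_cons]
      split_ifs <;> ring
    have hm := visA_mono G y t y
    have h0 := visA_nonneg G y (t + 1) x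
    calc _ = ∑ w, lazyStep G x w * (lazyWalkExp G w t
              (fun f => (visits y f : ℝ) * ((visits y f : ℝ) - 1)) +
              (if x = y then 2 else 0) * visA G y t w) := by simp_rw [key]
      _ ≤ ∑ w, lazyStep G x w * (2 * visA G y t y * visA G y t w +
              (if x = y then 2 else 0) * visA G y t w) := by
            gcongr with w
            · exact lazyStep_nonneg G x w
            · exact ih w
      _ = 2 * visA G y t y * (∑ w, lazyStep G x w * visA G y t w) +
            (if x = y then 2 else 0) * ∑ w, lazyStep G x w * visA G y t w := by
            rw [Finset.mul_sum, Finset.mul_sum, ← Finset.sum_add_distrib]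
            exact Finset.sum_congr rfl fun w _ => by ring
      _ ≤ 2 * visA G y t y * visA G y (t + 1) x := by
            have := step_le G hd _ _ (visA_le G hd y t) x
            rw [visA]
            split_ifs <;> linarith
      _ ≤ _ := by gcongr

end Aux

/-- second moment bound
`E[(N_t^x(y))²] ≤ E[N_t^x(y)] + 128·d(y)²·(t+1)` for all `t ≤ β·m²`. -/
theorem statement_1 :
    ∃ β : ℝ, 0 < β ∧
      ∀ (V : Type) [Fintype V] [DecidableEq V] (G : SimpleGraph V) [DecidableRel G.Adj],
        G.Connected → (∀ v : V, 1 ≤ G.degree v) →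
        ∀ x y : V, ∀ t : ℕ,
          (t : ℝ) ≤ β * (G.edgeFinset.card : ℝ) ^ 2 →
          lazyWalkExp G x t (fun f => ((visits y f : ℝ)) ^ 2) ≤
            lazyWalkExp G x t (fun f => (visits y f : ℝ)) +
              128 * (G.degree y : ℝ) ^ 2 * (t + 1) := by
  refine ⟨1, one_pos, ?_⟩
  intro V _ _ G _ hc hd x y t ht
  have h1 := exp_fact G hd x y t
  have h2 := visA_sq_le G hc hd y t ht
  have h3 := visA_le G hd y t x
  have h4 := visA_nonneg G y t y
  have h5 : lazyWalkExp G x t (fun f => ((visits y f : ℝ)) ^ 2) =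
      lazyWalkExp G x t (fun f => (visits y f : ℝ) * ((visits y f : ℝ) - 1)) +
        lazyWalkExp G x t (fun f => (visits y f : ℝ)) := by
    rw [← exp_add]
    congr 1
    funext f
    ring
  have h6 : visA G y t y * visA G y t x ≤ visA G y t y * visA G y t y := by gcongr
  have h7 : 0 ≤ (G.degree y : ℝ) ^ 2 * (t + 1) := by positivity
  rw [h5]
  nlinarith
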